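/- For every integer N ≥ 1, the family (𝒲_α)_{α∈Λ*_N} of Arar–Boulmezaoud functions indexed by Λ*_N = ∪_{k=0}^{N} Λ_k is a basis of the space H_N (in particular each 𝒲_α with α ∈ Λ*_N belongs to H_N, the family is linearly independent, and it spans H_N). -/

import Mathlib

open MeasureTheory Real Filter Metric
open scoped RealInnerProductSpace BigOperators

noncomputable section

abbrev E3 := EuclideanSpace ℝ (Fin 3)
abbrev E4 := EuclideanSpace ℝ (Fin 4)

/-- The index set `Λ = {(k,ℓ,m) : ℓ ≤ k, |m| ≤ ℓ}`. -/
def memLam (α : ℕ × ℕ × ℤ) : Prop := α.2.1 ≤ α.1 ∧ α.2.2.natAbs ≤ α.2.1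

/-- `Λ_k` as a finite set. -/
def LamK (k : ℕ) : Finset (ℕ × ℕ × ℤ) :=
  (Finset.range (k+1)).biUnion fun l => (Finset.Icc (-(l:ℤ)) (l:ℤ)).image fun m => (k, l, m)

/-- `Λ*_N = ∪_{k ≤ N} Λ_k`. -/
def LamStar (N : ℕ) : Finset (ℕ × ℕ × ℤ) := (Finset.range (N+1)).biUnion LamK

/-- Associated Legendre function `P_ℓ^m(t) = ((-1)^m/(2^ℓ ℓ!)) (1-t²)^{m/2} (d/dt)^{ℓ+m}(t²-1)^ℓ`. -/
def legendreP (l m : ℕ) (t : ℝ) : ℝ :=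
  ((-1:ℝ)^m / (2^l * (Nat.factorial l))) * (Real.sqrt (1 - t^2))^m *
    (Polynomial.derivative^[l+m] ((Polynomial.X^2 - 1 : Polynomial ℝ)^l)).eval t

/-- Normalized associated Legendre function `K_ℓ^m = (-1)^m √((ℓ-m)!/(ℓ+m)!) P_ℓ^m`. -/
def Kfun (l m : ℕ) (t : ℝ) : ℝ :=
  (-1:ℝ)^m * Real.sqrt ((Nat.factorial (l-m)) / (Nat.factorial (l+m))) * legendreP l m t

/-- The angular factor `y_m`. -/
def ymfun (m : ℤ) (φ : ℝ) : ℝ :=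
  if m = 0 then 1 / Real.sqrt 2
  else if 0 < m then Real.cos (m * φ)
  else Real.sin (|m| * φ)

/-- Real spherical harmonics `Y_{ℓ,m}` on `S²`. -/
def Y2fun (l : ℕ) (m : ℤ) (φ θ : ℝ) : ℝ :=
  Real.sqrt ((2*l+1)/(2*π)) * Kfun l m.natAbs (Real.cos θ) * ymfun m φ

/-- Normalization constants `a_{k,ℓ} = ((k+1)π/2)·(k+ℓ+1)!/(k-ℓ)!`. -/
def akl (k l : ℕ) : ℝ :=
  ((k+1) * π / 2) * (Nat.factorial (k+l+1)) / (Nat.factorial (k-l))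

/-- `d`-th derivative of the Chebyshev polynomial of the first kind `T_n`, evaluated at `t`. -/
def chebDeriv (n d : ℕ) (t : ℝ) : ℝ :=
  (Polynomial.derivative^[d] (Polynomial.Chebyshev.T ℝ (n : ℤ))).eval t

/-- Spherical harmonic `𝒴_α` on `S³`, as a function of the spherical coordinates `(φ,θ,χ)`:
`𝒴_α = a_{k,ℓ}^{-1/2} (sin χ)^ℓ T_{k+1}^{(ℓ+1)}(cos χ) Y_{ℓ,m}(φ,θ)`. -/
def Yfun (α : ℕ × ℕ × ℤ) (φ θ χ : ℝ) : ℝ :=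
  (1 / Real.sqrt (akl α.1 α.2.1)) * (Real.sin χ)^α.2.1 *
    chebDeriv (α.1+1) (α.2.1+1) (Real.cos χ) * Y2fun α.2.1 α.2.2 φ θ

/-- The azimuthal spherical coordinate `φ` of `π⁻¹(x)`. -/
def sphPhi (x : E3) : ℝ := Complex.arg ⟨x 0, x 1⟩

/-- The polar spherical coordinate `θ` of `π⁻¹(x)`, i.e. `cos θ = x₃/|x|`. -/
def sphTheta (x : E3) : ℝ := Real.arccos (x 2 / ‖x‖)

/-- The spherical coordinate `χ` of `π⁻¹(x)`, i.e. `cos χ = (|x|²-1)/(|x|²+1)`. -/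
def sphChi (x : E3) : ℝ := Real.arccos ((‖x‖^2 - 1) / (‖x‖^2 + 1))

/-- The Arar–Boulmezaoud function `𝒲_α(x) = (2/(|x|²+1))^{1/2} 𝒴_α(π⁻¹(x))`. -/
def Wfun (α : ℕ × ℕ × ℤ) (x : E3) : ℝ :=
  Real.sqrt (2 / (‖x‖^2 + 1)) * Yfun α (sphPhi x) (sphTheta x) (sphChi x)

/-- Membership in `H_N`: `v(x) = Σ_{k=0}^N p_k(x)/(|x|²+1)^{k+1/2}` with `deg p_k ≤ k`. -/
def memHN (N : ℕ) (v : E3 → ℝ) : Prop :=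
  ∃ p : ℕ → MvPolynomial (Fin 3) ℝ,
    (∀ k, k ≤ N → (p k).totalDegree ≤ k) ∧
    ∀ x : E3, v x = ∑ k ∈ Finset.range (N+1),
      (MvPolynomial.eval (fun j => x j) (p k)) / (‖x‖^2+1) ^ ((k:ℝ) + 1/2)

/-- The space `H_N`, as a submodule of the real functions on `ℝ³`. -/
def HNspace (N : ℕ) : Submodule ℝ (E3 → ℝ) := Submodule.span ℝ {v | memHN N v}


/-! ### Linear independence by separation of variables -/

/-- If `f` is linearly independent and each `g i` is linearly independent, then so are the
products `f i a * g i j b` in separated variables. -/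
theorem linearIndependent_mul_separated {ι κ A B : Type*} {f : ι → A → ℝ} {g : ι → κ → B → ℝ}
    (hf : LinearIndependent ℝ f) (hg : ∀ i, LinearIndependent ℝ (g i)) :
    LinearIndependent ℝ (fun (p : ι × κ) (q : A × B) => f p.1 q.1 * g p.1 p.2 q.2) := by
  classical
  rw [linearIndependent_iff]
  intro c hc
  have h1 : ∀ (b : B) (i : ι), (c.curry i).sum (fun j y => y * g i j b) = 0 := by
    intro b
    have key := linearIndependent_iff.1 hf
      (Finsupp.onFinset c.curry.support (fun i => (c.curry i).sum (fun j y => y * g i j b))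
        (by
          intro i hi
          rw [Finsupp.mem_support_iff]
          rintro h
          simp [h] at hi)) ?_
    · intro i
      simpa using DFunLike.congr_fun key i
    · funext a
      have := congrFun hc (a, b)
      rw [Finsupp.linearCombination_apply, Finsupp.sum, Finset.sum_apply] at this
      rw [Finsupp.linearCombination_apply, Finsupp.onFinset_sum _ (by simp), Finset.sum_apply,
        Pi.zero_apply]
      rw [Pi.zero_apply] at this
      rw [← this]
      simp only [Pi.smul_apply, smul_eq_mul]
      have h2 := Finsupp.sum_curry_index c
        (fun i j y => y * (f i a * g i j b))
      simp only [Finsupp.sum] at h2 ⊢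
      rw [← h2]
      refine Finset.sum_congr rfl fun i _ => ?_
      rw [Finset.sum_mul]
      exact Finset.sum_congr rfl fun j _ => by ring
  ext ⟨i, j⟩
  have := linearIndependent_iff.1 (hg i) (c.curry i) (by
    funext b
    rw [Finsupp.linearCombination_apply, Finsupp.sum, Finset.sum_apply]
    simpa [Finsupp.sum] using h1 b i)
  simpa using DFunLike.congr_fun this j

/-- Multiplication by a nowhere vanishing function preserves linear independence. -/
theorem LinearIndependent.mul_nonvanishing {ι A : Type*} {f : ι → A → ℝ}
    (hf : LinearIndependent ℝ f) (h : A → ℝ) (hh : ∀ a, h a ≠ 0) :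
    LinearIndependent ℝ (fun i a => h a * f i a) := by
  refine hf.map' (LinearMap.mulLeft ℝ h) (LinearMap.ker_eq_bot'.2 fun v hv => ?_)
  funext a
  have := congrFun hv a
  simpa [hh a] using this

/-- Polynomials of degrees `0, 1, 2, …` stay linearly independent after substituting a function
with infinite range. -/
theorem linearIndependent_eval_of_degree {A : Type*} {g : A → ℝ} (hg : (Set.range g).Infinite)
    (P : ℕ → Polynomial ℝ) (hP : ∀ i, (P i).degree = i) :
    LinearIndependent ℝ (fun i a => (P i).eval (g a)) := by
  let S : Polynomial.Sequence ℝ := ⟨P, hP⟩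
  refine S.linearIndependent.map' (LinearMap.pi fun a => Polynomial.leval (g a))
    (LinearMap.ker_eq_bot'.2 fun p hp => ?_)
  refine Polynomial.eq_zero_of_infinite_isRoot p (hg.mono ?_)
  rintro _ ⟨a, rfl⟩
  exact congrFun hp a

/-- The degree of an iterated derivative in characteristic zero. -/
theorem degree_iterate_derivative_eq {p : Polynomial ℝ} {n d : ℕ}
    (hp : p.natDegree = n + d) (h0 : p ≠ 0) :
    (Polynomial.derivative^[d] p).degree = n := by
  refine Polynomial.degree_eq_of_le_of_coeff_ne_zero ?_ ?_
  · refine Polynomial.degree_le_of_natDegree_le ?_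
    have := Polynomial.natDegree_iterate_derivative p d
    omega
  · rw [Polynomial.coeff_iterate_derivative, nsmul_eq_mul, ← hp]
    refine mul_ne_zero ?_ (by simpa using h0)
    rw [Nat.cast_ne_zero, hp]
    exact (Nat.descFactorial_pos.2 (by omega)).ne'

theorem natDegree_X_sq_sub_one_pow (l : ℕ) :
    ((Polynomial.X ^ 2 - 1 : Polynomial ℝ) ^ l).natDegree = 2 * l := by
  rw [Polynomial.natDegree_pow, ← Polynomial.C_1, Polynomial.natDegree_X_pow_sub_C, mul_comm]

theorem X_sq_sub_one_pow_ne_zero (l : ℕ) : (Polynomial.X ^ 2 - 1 : Polynomial ℝ) ^ l ≠ 0 :=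
  pow_ne_zero _ (by rw [← Polynomial.C_1]; exact Polynomial.X_pow_sub_C_ne_zero (by norm_num) _)

/-- The polynomial factor of the associated Legendre function `P_{m+p}^m` has degree `p`. -/
theorem degree_legendre_factor (m p : ℕ) :
    (Polynomial.derivative^[m + p + m]
      ((Polynomial.X ^ 2 - 1 : Polynomial ℝ) ^ (m + p))).degree = p :=
  degree_iterate_derivative_eq (by rw [natDegree_X_sq_sub_one_pow]; ring)
    (X_sq_sub_one_pow_ne_zero _)

theorem degree_chebyshev_factor (l q : ℕ) :
    (Polynomial.derivative^[l + 1]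
      (Polynomial.Chebyshev.T ℝ ((l + q + 1 : ℕ) : ℤ))).degree = q := by
  have h : (Polynomial.Chebyshev.T ℝ ((l + q + 1 : ℕ) : ℤ)).natDegree = q + (l + 1) := by
    rw [Polynomial.Chebyshev.natDegree_T, Int.natAbs_natCast]; ring
  exact degree_iterate_derivative_eq h fun h0 => by
    rw [h0, Polynomial.natDegree_zero] at h
    omega

/-- Angles in `(-π, π)` away from `0`. -/
abbrev PuncturedAngle := {φ : ℝ // φ ≠ 0 ∧ |φ| < π}

theorem sin_ne_zero_of_puncturedAngle (φ : PuncturedAngle) : Real.sin φ ≠ 0 := by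
  obtain ⟨φ, h0, hφ⟩ := φ
  rw [abs_lt] at hφ
  rcases lt_or_gt_of_ne h0 with h | h
  · exact (Real.sin_neg_of_neg_of_neg_pi_lt h hφ.1).ne
  · exact (Real.sin_pos_of_pos_of_lt_pi h hφ.2).ne'

theorem infinite_range_cos_puncturedAngle :
    (Set.range fun φ : PuncturedAngle => Real.cos φ).Infinite := by
  refine (Set.Ioo_infinite (show (-1 : ℝ) < 1 by norm_num)).mono fun t ht => ?_
  have h0 : Real.arccos t ≠ 0 := fun h => by
    rw [Real.arccos_eq_zero] at h; exact absurd ht.2 (not_lt.2 h)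
  have hπ : Real.arccos t ≠ π := fun h => by
    rw [Real.arccos_eq_pi] at h; exact absurd ht.1 (not_lt.2 h)
  refine ⟨⟨Real.arccos t, h0, ?_⟩, Real.cos_arccos ht.1.le ht.2.le⟩
  rw [abs_of_nonneg (Real.arccos_nonneg t)]
  exact lt_of_le_of_ne (Real.arccos_le_pi t) hπ

theorem linearIndependent_ymfun :
    LinearIndependent ℝ (fun (m : ℤ) (φ : PuncturedAngle) => ymfun m φ) := by
  let P : ℕ → Polynomial ℝ := fun n =>
    if n = 0 then Polynomial.C (1 / Real.sqrt 2) else Polynomial.Chebyshev.T ℝ (n : ℤ)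
  have hP : ∀ n, (P n).degree = n := by
    intro n
    by_cases h : n = 0
    · subst h
      simp [P, Polynomial.degree_C]
    · simp [P, h, Polynomial.Chebyshev.degree_T]
  have heven := linearIndependent_eval_of_degree infinite_range_cos_puncturedAngle P hP
  have hodd := (linearIndependent_eval_of_degree infinite_range_cos_puncturedAngle
    (fun n => Polynomial.Chebyshev.U ℝ (n : ℤ))
    (Polynomial.Chebyshev.degree_U_natCast ℝ)).mul_nonvanishing _ sin_ne_zero_of_puncturedAngle
  let neg : PuncturedAngle → PuncturedAngle := fun φ => ⟨-φ, by simpa using φ.2⟩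
  have hsum := heven.sum_type hodd (by
    rw [Submodule.disjoint_def]
    intro f hf1 hf2
    have e1 : ∀ φ, f (neg φ) = f φ := by
      clear hf2
      induction hf1 using Submodule.span_induction with
      | mem x h => obtain ⟨n, rfl⟩ := h; intro φ; simp [neg]
      | zero => simp
      | add x y _ _ hx hy => intro φ; simp [hx, hy]
      | smul a x _ hx => intro φ; simp [hx]
    have e2 : ∀ φ, f (neg φ) = - f φ := by
      clear hf1 e1
      induction hf2 using Submodule.span_induction with
      | mem x h => obtain ⟨n, rfl⟩ := h; intro φ; simp [neg]
      | zero => simp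
      | add x y _ _ hx hy => intro φ; simp [hx, hy]; ring
      | smul a x _ hx => intro φ; simp [hx]
    funext φ
    have h1 := e1 φ
    have h2 := e2 φ
    simp only [Pi.zero_apply]
    linarith)
  have hcomp := hsum.comp Equiv.intEquivNatSumNat Equiv.intEquivNatSumNat.injective
  suffices h : (fun (m : ℤ) (φ : PuncturedAngle) => ymfun m φ) = _ ∘ _ by rw [h]; exact hcomp
  funext m φ
  obtain n | n := m
  · change ymfun (n : ℤ) φ = (P n).eval (Real.cos φ)
    by_cases h : n = 0
    · simp [ymfun, P, h]
    · simp [ymfun, P, h, Nat.pos_of_ne_zero h, Polynomial.Chebyshev.T_real_cos]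
  · change ymfun (Int.negSucc n) φ =
      Real.sin φ * (Polynomial.Chebyshev.U ℝ (n : ℤ)).eval (Real.cos φ)
    rw [mul_comm, Polynomial.Chebyshev.U_real_cos]
    have h0 : Int.negSucc n ≠ 0 := by omega
    have h1 : ¬ 0 < Int.negSucc n := by omega
    rw [ymfun, if_neg h0, if_neg h1, abs_of_nonpos (not_lt.1 h1),
      show -Int.negSucc n = (n : ℤ) + 1 by omega]
    push_cast
    rfl

/-! ### Linear independence of the Arar–Boulmezaoud functions -/

/-- The point of `ℝ³` whose inverse stereographic projection has spherical coordinates `φ`, `θ`,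
`χ` with `cos θ = t` and `cos χ = c`. -/
def stereoPoint (φ t c : ℝ) : E3 :=
  !₂[√((1 + c) / (1 - c)) * √(1 - t ^ 2) * Real.cos φ,
    √((1 + c) / (1 - c)) * √(1 - t ^ 2) * Real.sin φ, √((1 + c) / (1 - c)) * t]

section stereoPoint

variable {φ t c : ℝ}

theorem one_sub_sq_pos (ht : t ∈ Set.Ioo (-1 : ℝ) 1) : 0 < 1 - t ^ 2 := by
  nlinarith [ht.1, ht.2]

theorem radius_sq_pos (hc : c ∈ Set.Ioo (-1 : ℝ) 1) : 0 < (1 + c) / (1 - c) :=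
  div_pos (by linarith [hc.1]) (by linarith [hc.2])

theorem norm_sq_stereoPoint (φ : ℝ) (ht : t ∈ Set.Ioo (-1 : ℝ) 1) (hc : c ∈ Set.Ioo (-1 : ℝ) 1) :
    ‖stereoPoint φ t c‖ ^ 2 = (1 + c) / (1 - c) := by
  rw [EuclideanSpace.real_norm_sq_eq, Fin.sum_univ_three]
  simp only [stereoPoint, PiLp.toLp_apply, Matrix.cons_val]
  have h1 := Real.sq_sqrt (radius_sq_pos hc).le
  have h2 := Real.sq_sqrt (one_sub_sq_pos ht).le
  have h3 := Real.sin_sq_add_cos_sq φ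
  calc _ = √((1 + c) / (1 - c)) ^ 2 *
      (√(1 - t ^ 2) ^ 2 * (Real.sin φ ^ 2 + Real.cos φ ^ 2) + t ^ 2) := by ring
    _ = _ := by rw [h1, h2, h3]; ring

theorem norm_stereoPoint (φ : ℝ) (ht : t ∈ Set.Ioo (-1 : ℝ) 1) (hc : c ∈ Set.Ioo (-1 : ℝ) 1) :
    ‖stereoPoint φ t c‖ = √((1 + c) / (1 - c)) := by
  rw [← norm_sq_stereoPoint φ ht hc, Real.sqrt_sq (norm_nonneg _)]

theorem sphPhi_stereoPoint (hφ : |φ| < π) (ht : t ∈ Set.Ioo (-1 : ℝ) 1)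
    (hc : c ∈ Set.Ioo (-1 : ℝ) 1) : sphPhi (stereoPoint φ t c) = φ := by
  have hr : 0 < √((1 + c) / (1 - c)) * √(1 - t ^ 2) :=
    mul_pos (Real.sqrt_pos.2 (radius_sq_pos hc)) (Real.sqrt_pos.2 (one_sub_sq_pos ht))
  rw [abs_lt] at hφ
  refine Eq.trans ?_ (Complex.arg_mul_cos_add_sin_mul_I hr ⟨hφ.1, hφ.2.le⟩)
  rw [sphPhi]
  congr 1
  apply Complex.ext <;> simp [stereoPoint, ← Complex.ofReal_cos, ← Complex.ofReal_sin]

theorem cos_sphTheta_stereoPoint (φ : ℝ) (ht : t ∈ Set.Ioo (-1 : ℝ) 1)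
    (hc : c ∈ Set.Ioo (-1 : ℝ) 1) : Real.cos (sphTheta (stereoPoint φ t c)) = t := by
  have hr : √((1 + c) / (1 - c)) ≠ 0 := (Real.sqrt_pos.2 (radius_sq_pos hc)).ne'
  rw [sphTheta, norm_stereoPoint φ ht hc]
  simp only [stereoPoint, PiLp.toLp_apply, Matrix.cons_val]
  rw [mul_div_cancel_left₀ _ hr, Real.cos_arccos ht.1.le ht.2.le]

theorem sphChi_stereoPoint (φ : ℝ) (ht : t ∈ Set.Ioo (-1 : ℝ) 1) (hc : c ∈ Set.Ioo (-1 : ℝ) 1) :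
    sphChi (stereoPoint φ t c) = Real.arccos c := by
  have h : 1 - c ≠ 0 := by linarith [hc.2]
  rw [sphChi, norm_sq_stereoPoint φ ht hc]
  congr 1
  field_simp
  ring

end stereoPoint

/-- The normalization factor of `𝒲_α` collected from all its constituents. -/
def normFactor (α : ℕ × ℕ × ℤ) : ℝ :=
  1 / √(akl α.1 α.2.1) * √((2 * α.2.1 + 1) / (2 * π)) *
    ((-1) ^ α.2.2.natAbs * √((Nat.factorial (α.2.1 - α.2.2.natAbs)) /
      (Nat.factorial (α.2.1 + α.2.2.natAbs)))) *
    ((-1) ^ α.2.2.natAbs / (2 ^ α.2.1 * (Nat.factorial α.2.1)))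

theorem normFactor_ne_zero (α : ℕ × ℕ × ℤ) : normFactor α ≠ 0 := by
  have h1 : 0 < akl α.1 α.2.1 := by unfold akl; positivity
  have h2 : (-1 : ℝ) ^ α.2.2.natAbs ≠ 0 := pow_ne_zero _ (by norm_num)
  unfold normFactor
  refine mul_ne_zero (mul_ne_zero (by positivity) (mul_ne_zero h2 (by positivity)))
    (div_ne_zero h2 (by positivity))

theorem Wfun_eq (k l : ℕ) (m : ℤ) (x : E3) :
    Wfun (k, l, m) x = normFactor (k, l, m) * (√(2 / (‖x‖ ^ 2 + 1)) *
      (ymfun m (sphPhi x) *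
        ((√(1 - Real.cos (sphTheta x) ^ 2) ^ m.natAbs *
          (Polynomial.derivative^[l + m.natAbs] ((Polynomial.X ^ 2 - 1 : Polynomial ℝ) ^ l)).eval
            (Real.cos (sphTheta x))) *
        (Real.sin (sphChi x) ^ l * chebDeriv (k + 1) (l + 1) (Real.cos (sphChi x)))))) := by
  simp only [Wfun, Yfun, Y2fun, Kfun, legendreP, normFactor]
  ring

theorem infinite_range_val_Ioo :
    (Set.range (Subtype.val : Set.Ioo (-1 : ℝ) 1 → ℝ)).Infinite := by
  rw [Subtype.range_coe]
  exact Set.Ioo_infinite (by norm_num)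

/-- The polar factor of `𝒲_α` as a function of `t = cos θ`, with `ℓ = m + p`. -/
def polarFactor (m p : ℕ) (t : Set.Ioo (-1 : ℝ) 1) : ℝ :=
  √(1 - (t : ℝ) ^ 2) ^ m *
    (Polynomial.derivative^[m + p + m]
      ((Polynomial.X ^ 2 - 1 : Polynomial ℝ) ^ (m + p))).eval (t : ℝ)

/-- The radial factor of `𝒲_α` as a function of `c = cos χ`, with `k = ℓ + q`. -/
def radialFactor (l q : ℕ) (c : Set.Ioo (-1 : ℝ) 1) : ℝ :=
  Real.sin (Real.arccos c) ^ l * chebDeriv (l + q + 1) (l + 1) c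

theorem linearIndependent_polarFactor (m : ℕ) : LinearIndependent ℝ (polarFactor m) :=
  (linearIndependent_eval_of_degree infinite_range_val_Ioo _
    (degree_legendre_factor m)).mul_nonvanishing
    (fun t : Set.Ioo (-1 : ℝ) 1 => √(1 - (t : ℝ) ^ 2) ^ m)
    fun t => pow_ne_zero _ (Real.sqrt_pos.2 (one_sub_sq_pos t.2)).ne'

theorem linearIndependent_radialFactor (l : ℕ) : LinearIndependent ℝ (radialFactor l) := by
  refine (linearIndependent_eval_of_degree infinite_range_val_Ioo _
    (degree_chebyshev_factor l)).mul_nonvanishing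
    (fun c : Set.Ioo (-1 : ℝ) 1 => Real.sin (Real.arccos c) ^ l) fun c => pow_ne_zero _ ?_
  rw [Real.sin_arccos]
  exact (Real.sqrt_pos.2 (one_sub_sq_pos c.2)).ne'

/-- The separated products underlying `𝒲_α`, with `m`, `ℓ - |m|` and `k - ℓ` as independent
indices. -/
def separatedProduct (i : ℤ × ℕ × ℕ)
    (q : PuncturedAngle × Set.Ioo (-1 : ℝ) 1 × Set.Ioo (-1 : ℝ) 1) : ℝ :=
  ymfun i.1 q.1 *
    (polarFactor i.1.natAbs i.2.1 q.2.1 * radialFactor (i.1.natAbs + i.2.1) i.2.2 q.2.2)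

theorem linearIndependent_separatedProduct : LinearIndependent ℝ separatedProduct :=
  linearIndependent_mul_separated linearIndependent_ymfun fun m =>
    linearIndependent_mul_separated (linearIndependent_polarFactor m.natAbs)
      fun p => linearIndependent_radialFactor (m.natAbs + p)

theorem mem_LamStar {N k l : ℕ} {m : ℤ} :
    (k, l, m) ∈ LamStar N ↔ k ≤ N ∧ l ≤ k ∧ m.natAbs ≤ l := by
  simp only [LamStar, LamK, Finset.mem_biUnion, Finset.mem_range, Finset.mem_image,
    Finset.mem_Icc, Prod.mk.injEq]
  constructor
  · rintro ⟨k', hk, l', hl, m', hm, rfl, rfl, rfl⟩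
    omega
  · rintro ⟨hk, hl, hm⟩
    exact ⟨k, by omega, l, by omega, m, by omega, rfl, rfl, rfl⟩

theorem linearIndependent_Wfun (N : ℕ) :
    LinearIndependent ℝ (fun α : {α // α ∈ LamStar N} => Wfun α.1) := by
  let e : {α // α ∈ LamStar N} → ℤ × ℕ × ℕ := fun α =>
    (α.1.2.2, α.1.2.1 - α.1.2.2.natAbs, α.1.1 - α.1.2.1)
  have he : Function.Injective e := by
    rintro ⟨⟨k, l, m⟩, h⟩ ⟨⟨k', l', m'⟩, h'⟩ heq
    rw [mem_LamStar] at h h'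
    simp only [e, Prod.mk.injEq] at heq
    obtain ⟨rfl, h1, h2⟩ := heq
    simp only [Subtype.mk.injEq, Prod.mk.injEq, and_true]
    omega
  let pt : PuncturedAngle × Set.Ioo (-1 : ℝ) 1 × Set.Ioo (-1 : ℝ) 1 → E3 :=
    fun q => stereoPoint q.1 q.2.1 q.2.2
  have hli := ((linearIndependent_separatedProduct.comp e he).units_smul
    (fun α => Units.mk0 _ (normFactor_ne_zero α.1))).mul_nonvanishing
    (fun q => √(2 / (‖pt q‖ ^ 2 + 1))) (fun q => by positivity)
  refine LinearIndependent.of_comp (LinearMap.funLeft ℝ ℝ pt) ?_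
  suffices h : (LinearMap.funLeft ℝ ℝ pt) ∘ (fun α : {α // α ∈ LamStar N} => Wfun α.1) = _ by
    rw [h]; exact hli
  funext ⟨⟨k, l, m⟩, hα⟩ ⟨φ, t, c⟩
  rw [mem_LamStar] at hα
  obtain ⟨-, hl, hm⟩ := hα
  obtain ⟨p, rfl⟩ := Nat.exists_eq_add_of_le hm
  obtain ⟨q, rfl⟩ := Nat.exists_eq_add_of_le hl
  simp only [Function.comp_apply, LinearMap.funLeft_apply, pt, Wfun_eq, e, separatedProduct, polarFactor, radialFactor,
    sphPhi_stereoPoint φ.2.2 t.2 c.2, cos_sphTheta_stereoPoint φ t.2 c.2,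
    sphChi_stereoPoint φ t.2 c.2, Real.cos_arccos c.2.1.le c.2.2.le, Nat.add_sub_cancel_left,
    Pi.smul_apply', Pi.smul_apply, Units.smul_mk0, smul_eq_mul]
  ring

/-! ### Functions on `ℝ³` that are polynomial in the stereographic coordinates -/

/-- The conformal factor `1 / (|x|² + 1)`. -/
def conf (x : E3) : ℝ := (‖x‖ ^ 2 + 1)⁻¹

/-- Monomials in the functions `x_j / (|x|² + 1)` and `1 / (|x|² + 1)`. -/
def stereoMonomial (a b c e : ℕ) (x : E3) : ℝ :=
  (x 0 * conf x) ^ a * (x 1 * conf x) ^ b * (x 2 * conf x) ^ c * conf x ^ e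

/-- Functions that are polynomials of degree at most `n` on `S³` in stereographic coordinates. -/
def stereoFiltration (n : ℕ) : Submodule ℝ (E3 → ℝ) :=
  Submodule.span ℝ {f | ∃ a b c e, a + b + c + e ≤ n ∧ f = stereoMonomial a b c e}

theorem conf_mul (x : E3) : conf x * (‖x‖ ^ 2 + 1) = 1 :=
  inv_mul_cancel₀ (by positivity)

theorem norm_sq_eq_sum (x : E3) : ‖x‖ ^ 2 = x 0 ^ 2 + x 1 ^ 2 + x 2 ^ 2 := by
  rw [EuclideanSpace.real_norm_sq_eq, Fin.sum_univ_three]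

theorem conf_sq (x : E3) :
    conf x ^ 2 = conf x - ((x 0 * conf x) ^ 2 + (x 1 * conf x) ^ 2 + (x 2 * conf x) ^ 2) := by
  have h := conf_mul x
  rw [norm_sq_eq_sum] at h
  linear_combination conf x * h

theorem stereoMonomial_mem {a b c e n : ℕ} (h : a + b + c + e ≤ n) :
    stereoMonomial a b c e ∈ stereoFiltration n :=
  Submodule.subset_span ⟨a, b, c, e, h, rfl⟩

theorem stereoFiltration_mono {m n : ℕ} (h : m ≤ n) :
    stereoFiltration m ≤ stereoFiltration n := by
  refine Submodule.span_mono ?_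
  rintro _ ⟨a, b, c, e, he, rfl⟩
  exact ⟨a, b, c, e, he.trans h, rfl⟩

theorem mul_mem_stereoFiltration {m n : ℕ} {f g : E3 → ℝ} (hf : f ∈ stereoFiltration m)
    (hg : g ∈ stereoFiltration n) : (fun x => f x * g x) ∈ stereoFiltration (m + n) := by
  have h := Submodule.mul_mem_mul hf hg
  rw [stereoFiltration, stereoFiltration, Submodule.span_mul_span] at h
  refine Submodule.span_le.2 ?_ h
  rintro _ ⟨_, ⟨a, b, c, e, he, rfl⟩, _, ⟨a', b', c', e', he', rfl⟩, rfl⟩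
  refine Submodule.subset_span ⟨a + a', b + b', c + c', e + e', by omega, ?_⟩
  funext x
  simp only [stereoMonomial, Pi.mul_apply]
  ring

theorem const_mem_stereoFiltration (r : ℝ) (n : ℕ) : (fun _ => r) ∈ stereoFiltration n := by
  have h := (stereoFiltration n).smul_mem r
    (stereoMonomial_mem (a := 0) (b := 0) (c := 0) (e := 0) (Nat.zero_le n))
  refine (congrArg (· ∈ stereoFiltration n) ?_).mp h
  funext x
  simp [stereoMonomial]

theorem const_mul_mem_stereoFiltration (r : ℝ) {n : ℕ} {f : E3 → ℝ}
    (hf : f ∈ stereoFiltration n) : (fun x => r * f x) ∈ stereoFiltration n :=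
  (stereoFiltration n).smul_mem r hf

theorem pow_mem_stereoFiltration {n : ℕ} {f : E3 → ℝ} (hf : f ∈ stereoFiltration n) (d : ℕ) :
    (fun x => f x ^ d) ∈ stereoFiltration (n * d) := by
  induction d with
  | zero => simpa using const_mem_stereoFiltration 1 0
  | succ d ih =>
    simp only [pow_succ]
    exact mul_mem_stereoFiltration ih hf

theorem sum_mem_stereoFiltration {ι : Type*} {s : Finset ι} {n : ℕ} {f : ι → E3 → ℝ}
    (hf : ∀ i ∈ s, f i ∈ stereoFiltration n) :
    (fun x => ∑ i ∈ s, f i x) ∈ stereoFiltration n := by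
  have h := Submodule.sum_mem _ hf
  rwa [show ∑ i ∈ s, f i = fun x => ∑ i ∈ s, f i x by funext x; simp] at h

theorem eval_mem_stereoFiltration {f : E3 → ℝ} (hf : f ∈ stereoFiltration 1) {p : Polynomial ℝ}
    {d : ℕ} (hp : p.natDegree ≤ d) : (fun x => p.eval (f x)) ∈ stereoFiltration d := by
  simp only [Polynomial.eval_eq_sum_range]
  refine sum_mem_stereoFiltration fun i hi => const_mul_mem_stereoFiltration _ ?_
  rw [Finset.mem_range] at hi
  exact stereoFiltration_mono (by omega) (pow_mem_stereoFiltration hf i)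

theorem coord_mem_stereoFiltration (j : Fin 3) :
    (fun x : E3 => x j * conf x) ∈ stereoFiltration 1 := by
  fin_cases j
  · convert stereoMonomial_mem (a := 1) (b := 0) (c := 0) (e := 0) le_rfl using 1
    funext x; simp [stereoMonomial]
  · convert stereoMonomial_mem (a := 0) (b := 1) (c := 0) (e := 0) le_rfl using 1
    funext x; simp [stereoMonomial]
  · convert stereoMonomial_mem (a := 0) (b := 0) (c := 1) (e := 0) le_rfl using 1
    funext x; simp [stereoMonomial]

theorem conf_mem_stereoFiltration : conf ∈ stereoFiltration 1 := by
  convert stereoMonomial_mem (a := 0) (b := 0) (c := 0) (e := 1) le_rfl using 1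
  funext x; simp [stereoMonomial]

/-! ### The spherical coordinates in terms of the stereographic ones -/

theorem conf_pos (x : E3) : 0 < conf x := by unfold conf; positivity

theorem cos_sphChi (x : E3) : Real.cos (sphChi x) = 1 - 2 * conf x := by
  have h : (‖x‖ ^ 2 - 1) / (‖x‖ ^ 2 + 1) = 1 - 2 * conf x := by
    unfold conf; field_simp; ring
  have h1 : conf x ≤ 1 := inv_le_one_of_one_le₀ (by nlinarith [sq_nonneg ‖x‖])
  rw [sphChi, h, Real.cos_arccos] <;> linarith [conf_pos x]

theorem sin_sphChi (x : E3) : Real.sin (sphChi x) = 2 * (‖x‖ * conf x) := by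
  have h : 0 ≤ 2 * (‖x‖ * conf x) := by have := conf_pos x; positivity
  have h2 := Real.sin_sq_add_cos_sq (sphChi x)
  rw [cos_sphChi] at h2
  refine (pow_left_inj₀ (Real.sin_nonneg_of_nonneg_of_le_pi (Real.arccos_nonneg _)
    (Real.arccos_le_pi _)) h two_ne_zero).1 ?_
  change Real.sin (sphChi x) ^ 2 = _
  linear_combination h2 - 4 * conf x * conf_mul x

theorem norm_mul_cos_sphTheta (x : E3) : ‖x‖ * Real.cos (sphTheta x) = x 2 := by
  have h : |x 2| ≤ ‖x‖ := by simpa using PiLp.norm_apply_le x 2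
  have h' : |x 2 / ‖x‖| ≤ 1 := by
    rw [abs_div, abs_norm]
    exact div_le_one_of_le₀ h (norm_nonneg _)
  rw [sphTheta, Real.cos_arccos (abs_le.1 h').1 (abs_le.1 h').2]
  rcases eq_or_ne ‖x‖ 0 with h0 | h0
  · rw [h0] at h ⊢
    rw [abs_nonpos_iff.1 h, zero_mul]
  · exact mul_div_cancel₀ _ h0

theorem norm_mul_sin_sphTheta (x : E3) :
    ‖x‖ * √(1 - Real.cos (sphTheta x) ^ 2) = ‖(⟨x 0, x 1⟩ : ℂ)‖ := by
  refine (pow_left_inj₀ (by positivity) (by positivity) two_ne_zero).1 ?_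
  have h : 0 ≤ 1 - Real.cos (sphTheta x) ^ 2 := by
    nlinarith [Real.sin_sq_add_cos_sq (sphTheta x), sq_nonneg (Real.sin (sphTheta x))]
  rw [mul_pow, Real.sq_sqrt h, Complex.sq_norm, Complex.normSq_mk, mul_sub, ← mul_pow,
    norm_mul_cos_sphTheta, norm_sq_eq_sum]
  ring

theorem sin_sphChi_mul_cos_sphTheta (x : E3) :
    Real.sin (sphChi x) * Real.cos (sphTheta x) = 2 * (x 2 * conf x) := by
  rw [sin_sphChi, ← norm_mul_cos_sphTheta]; ring

theorem sin_sphChi_mul_cos_sphPhi (x : E3) :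
    Real.sin (sphChi x) * √(1 - Real.cos (sphTheta x) ^ 2) * Real.cos (sphPhi x) =
      2 * (x 0 * conf x) := by
  have h := Complex.norm_mul_cos_arg ⟨x 0, x 1⟩
  rw [← norm_mul_sin_sphTheta] at h
  rw [sin_sphChi, sphPhi]
  linear_combination 2 * conf x * h

theorem sin_sphChi_mul_sin_sphPhi (x : E3) :
    Real.sin (sphChi x) * √(1 - Real.cos (sphTheta x) ^ 2) * Real.sin (sphPhi x) =
      2 * (x 1 * conf x) := by
  have h := Complex.norm_mul_sin_arg ⟨x 0, x 1⟩
  rw [← norm_mul_sin_sphTheta] at h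
  rw [sin_sphChi, sphPhi]
  linear_combination 2 * conf x * h

theorem sin_sphChi_sq_mem_stereoFiltration :
    (fun x => Real.sin (sphChi x) ^ 2) ∈ stereoFiltration 2 := by
  have h : (fun x => Real.sin (sphChi x) ^ 2) =
      fun x => 4 * ∑ j : Fin 3, (x j * conf x) ^ 2 := by
    funext x
    rw [sin_sphChi, Fin.sum_univ_three]
    linear_combination 4 * conf x ^ 2 * norm_sq_eq_sum x
  rw [h]
  exact const_mul_mem_stereoFiltration _ (sum_mem_stereoFiltration fun j _ =>
    pow_mem_stereoFiltration (coord_mem_stereoFiltration j) 2)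

/-- The azimuthal factors, multiplied by the distance to the polar axis to the power `m`. -/
theorem azimuthal_mem_stereoFiltration (m : ℕ) :
    (fun x => (Real.sin (sphChi x) * √(1 - Real.cos (sphTheta x) ^ 2)) ^ m *
      Real.cos (m * sphPhi x)) ∈ stereoFiltration m ∧
    (fun x => (Real.sin (sphChi x) * √(1 - Real.cos (sphTheta x) ^ 2)) ^ m *
      Real.sin (m * sphPhi x)) ∈ stereoFiltration m := by
  have h0 := const_mul_mem_stereoFiltration 2 (coord_mem_stereoFiltration 0)
  have h1 := const_mul_mem_stereoFiltration 2 (coord_mem_stereoFiltration 1)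
  simp only [← sin_sphChi_mul_cos_sphPhi, ← sin_sphChi_mul_sin_sphPhi] at h0 h1
  induction m with
  | zero =>
    simpa using ⟨const_mem_stereoFiltration 1 0, const_mem_stereoFiltration 0 0⟩
  | succ m ih =>
    constructor
    · convert (stereoFiltration (m + 1)).sub_mem (mul_mem_stereoFiltration ih.1 h0)
        (mul_mem_stereoFiltration ih.2 h1) using 1
      funext x
      rw [Pi.sub_apply, show ((m + 1 : ℕ) : ℝ) * sphPhi x = m * sphPhi x + sphPhi x by
        push_cast; ring, Real.cos_add]
      ring
    · convert (stereoFiltration (m + 1)).add_mem (mul_mem_stereoFiltration ih.2 h0)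
        (mul_mem_stereoFiltration ih.1 h1) using 1
      funext x
      rw [Pi.add_apply, show ((m + 1 : ℕ) : ℝ) * sphPhi x = m * sphPhi x + sphPhi x by
        push_cast; ring, Real.sin_add]
      ring

theorem ymfun_mem_stereoFiltration (m : ℤ) :
    (fun x => (Real.sin (sphChi x) * √(1 - Real.cos (sphTheta x) ^ 2)) ^ m.natAbs *
      ymfun m (sphPhi x)) ∈ stereoFiltration m.natAbs := by
  obtain ⟨hc, hs⟩ := azimuthal_mem_stereoFiltration m.natAbs
  unfold ymfun
  split_ifs with h0 h1
  · subst h0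
    simpa using const_mem_stereoFiltration (√2)⁻¹ 0
  · convert hc using 6
    rw [Nat.cast_natAbs, abs_of_pos h1]
  · convert hs using 6
    rw [Nat.cast_natAbs]

theorem coeff_legendre_factor_eq_zero {l m i : ℕ} (h : ¬ 2 ∣ i + (l + m)) :
    (Polynomial.derivative^[l + m] ((Polynomial.X ^ 2 - 1 : Polynomial ℝ) ^ l)).coeff i = 0 := by
  have hexp : (Polynomial.X ^ 2 - 1 : Polynomial ℝ) ^ l =
      Polynomial.expand ℝ 2 ((Polynomial.X - 1) ^ l) := by simp
  rw [Polynomial.coeff_iterate_derivative, hexp, Polynomial.coeff_expand two_pos, if_neg h,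
    smul_zero]

/-- The Legendre factor, homogenized by the distance to the origin in the first three
coordinates. -/
theorem legendre_mem_stereoFiltration {l m : ℕ} (hm : m ≤ l) :
    (fun x => Real.sin (sphChi x) ^ (l - m) *
      (Polynomial.derivative^[l + m] ((Polynomial.X ^ 2 - 1 : Polynomial ℝ) ^ l)).eval
        (Real.cos (sphTheta x))) ∈ stereoFiltration (l - m) := by
  have hdeg := Polynomial.natDegree_iterate_derivative
    ((Polynomial.X ^ 2 - 1 : Polynomial ℝ) ^ l) (l + m)
  rw [natDegree_X_sq_sub_one_pow] at hdeg
  have hz := const_mul_mem_stereoFiltration 2 (coord_mem_stereoFiltration 2)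
  simp only [← sin_sphChi_mul_cos_sphTheta] at hz
  simp only [Polynomial.eval_eq_sum_range, Finset.mul_sum]
  refine sum_mem_stereoFiltration fun i hi => ?_
  rw [Finset.mem_range] at hi
  by_cases hpar : 2 ∣ i + (l + m)
  · obtain ⟨j, hj⟩ : ∃ j, l - m = i + 2 * j := ⟨(l - m - i) / 2, by omega⟩
    convert const_mul_mem_stereoFiltration ((Polynomial.derivative^[l + m]
      ((Polynomial.X ^ 2 - 1 : Polynomial ℝ) ^ l)).coeff i)
      (mul_mem_stereoFiltration (pow_mem_stereoFiltration hz i)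
        (pow_mem_stereoFiltration sin_sphChi_sq_mem_stereoFiltration j)) using 1
    · rw [hj, one_mul]
    · funext x
      rw [hj]
      ring
  · simpa [coeff_legendre_factor_eq_zero hpar] using const_mem_stereoFiltration 0 (l - m)

/-! ### Comparison with `H_N` -/

/-- Multiplication by `(|x|² + 1)^{-1/2}`. -/
def mulWeight : (E3 → ℝ) →ₗ[ℝ] (E3 → ℝ) := LinearMap.mulLeft ℝ fun x => (√(‖x‖ ^ 2 + 1))⁻¹

theorem mulWeight_apply (f : E3 → ℝ) (x : E3) : mulWeight f x = (√(‖x‖ ^ 2 + 1))⁻¹ * f x := rfl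

theorem Wfun_mem_map_mulWeight {k l : ℕ} {m : ℤ} (hl : l ≤ k) (hm : m.natAbs ≤ l) :
    Wfun (k, l, m) ∈ (stereoFiltration k).map mulWeight := by
  have hcos : (fun x => Real.cos (sphChi x)) ∈ stereoFiltration 1 := by
    simp only [cos_sphChi]
    exact (stereoFiltration 1).sub_mem (const_mem_stereoFiltration 1 1)
      (const_mul_mem_stereoFiltration 2 conf_mem_stereoFiltration)
  obtain ⟨q, rfl⟩ := Nat.exists_eq_add_of_le hl
  have hcheb := eval_mem_stereoFiltration hcos
    (Polynomial.natDegree_le_of_degree_le (degree_chebyshev_factor l q).le)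
  have hmem := const_mul_mem_stereoFiltration (√2 * normFactor (l + q, l, m))
    (mul_mem_stereoFiltration
      (mul_mem_stereoFiltration (ymfun_mem_stereoFiltration m) (legendre_mem_stereoFiltration hm))
      hcheb)
  rw [Nat.add_sub_cancel' hm] at hmem
  refine ⟨_, hmem, ?_⟩
  funext x
  have hpow : Real.sin (sphChi x) ^ l =
      Real.sin (sphChi x) ^ m.natAbs * Real.sin (sphChi x) ^ (l - m.natAbs) := by
    rw [← pow_add, Nat.add_sub_cancel' hm]
  rw [mulWeight_apply, Wfun_eq, Real.sqrt_div zero_le_two, hpow, chebDeriv]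
  ring

theorem rpow_nat_add_half (k : ℕ) (x : E3) :
    (‖x‖ ^ 2 + 1) ^ ((k : ℝ) + 1 / 2) = (‖x‖ ^ 2 + 1) ^ k * √(‖x‖ ^ 2 + 1) := by
  rw [Real.rpow_add (by positivity), Real.rpow_natCast, Real.sqrt_eq_rpow]

theorem eval_mul_conf_pow_mem_stereoFiltration {k : ℕ} {p : MvPolynomial (Fin 3) ℝ}
    (hp : p.totalDegree ≤ k) :
    (fun x : E3 => MvPolynomial.eval (fun j => x j) p * conf x ^ k) ∈ stereoFiltration k := by
  simp only [MvPolynomial.eval_eq', Finset.sum_mul]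
  refine sum_mem_stereoFiltration fun d hd => ?_
  have hdeg := (MvPolynomial.le_totalDegree hd).trans hp
  rw [Finsupp.sum_fintype _ _ (fun _ => rfl), Fin.sum_univ_three] at hdeg
  obtain ⟨e, rfl⟩ := Nat.exists_eq_add_of_le hdeg
  convert const_mul_mem_stereoFiltration (p.coeff d)
    (stereoMonomial_mem (a := d 0) (b := d 1) (c := d 2) (e := e) le_rfl) using 1
  funext x
  simp only [stereoMonomial, Fin.prod_univ_three]
  ring

theorem HNspace_le_map_mulWeight (N : ℕ) :
    HNspace N ≤ (stereoFiltration N).map mulWeight := by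
  refine Submodule.span_le.2 ?_
  rintro v ⟨p, hp, hv⟩
  refine ⟨_, sum_mem_stereoFiltration (s := Finset.range (N + 1))
    (f := fun k x => MvPolynomial.eval (fun j => x j) (p k) * conf x ^ k) fun k hk => ?_,
    funext fun x => ?_⟩
  · rw [Finset.mem_range, Nat.lt_succ_iff] at hk
    exact stereoFiltration_mono hk (eval_mul_conf_pow_mem_stereoFiltration (hp k hk))
  · rw [mulWeight_apply, hv, Finset.mul_sum]
    refine Finset.sum_congr rfl fun k _ => ?_
    rw [rpow_nat_add_half, conf, inv_pow, div_eq_mul_inv, mul_inv]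
    ring

theorem map_mulWeight_le_HNspace (N : ℕ) :
    (stereoFiltration N).map mulWeight ≤ HNspace N := by
  rw [stereoFiltration, Submodule.map_span, Submodule.span_le]
  rintro _ ⟨_, ⟨a, b, c, e, he, rfl⟩, rfl⟩
  refine Submodule.subset_span ⟨fun k => if k = a + b + c + e then
    MvPolynomial.X 0 ^ a * MvPolynomial.X 1 ^ b * MvPolynomial.X 2 ^ c else 0, ?_, ?_⟩
  · intro k _
    dsimp only
    split_ifs with h
    · refine (MvPolynomial.totalDegree_mul _ _).trans ?_
      have := MvPolynomial.totalDegree_mul (MvPolynomial.X 0 ^ a : MvPolynomial (Fin 3) ℝ)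
        (MvPolynomial.X 1 ^ b)
      simp only [MvPolynomial.totalDegree_X_pow] at this ⊢
      omega
    · simp
  · intro x
    rw [Finset.sum_eq_single (a + b + c + e)]
    · dsimp only
      rw [if_pos rfl, rpow_nat_add_half, mulWeight_apply, stereoMonomial, conf, div_eq_mul_inv,
        mul_inv, ← inv_pow]
      simp only [map_mul, map_pow, MvPolynomial.eval_X]
      ring
    · intro k _ hk
      simp [hk]
    · intro h
      exact absurd (Finset.mem_range.2 (by omega)) h

/-! ### A spanning family indexed by `Λ*_N` -/

/-- The monomials of degree at most one in `1 / (|x|² + 1)`, enumerated by `Λ`. -/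
def reducedMonomial (α : ℕ × ℕ × ℤ) : E3 → ℝ :=
  if 0 ≤ α.2.2 then stereoMonomial (α.1 - α.2.1) (α.2.1 - α.2.2.natAbs) α.2.2.natAbs 0
  else stereoMonomial (α.1 - α.2.1) (α.2.1 - α.2.2.natAbs) (α.2.2.natAbs - 1) 1

theorem stereoFiltration_le_span_reducedMonomial (N : ℕ) :
    stereoFiltration N ≤
      Submodule.span ℝ (reducedMonomial '' (LamStar N : Set (ℕ × ℕ × ℤ))) := by
  refine Submodule.span_le.2 ?_
  rintro _ ⟨a, b, c, e, he, rfl⟩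
  rw [SetLike.mem_coe]
  induction e using Nat.strong_induction_on generalizing a b c with
  | _ e ih =>
    match e with
    | 0 =>
      refine Submodule.subset_span ⟨(a + b + c, b + c, (c : ℤ)), ?_, ?_⟩
      · rw [Finset.mem_coe, mem_LamStar]; omega
      · simp [reducedMonomial, add_assoc]
    | 1 =>
      refine Submodule.subset_span ⟨(a + b + c + 1, b + c + 1, -(c + 1 : ℤ)), ?_, ?_⟩
      · rw [Finset.mem_coe, mem_LamStar]; omega
      · have h1 : ¬ (0 : ℤ) ≤ -(c + 1 : ℤ) := by omega
        have h2 : (-(c + 1 : ℤ)).natAbs = c + 1 := by omega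
        rw [reducedMonomial, if_neg h1, h2]
        congr 1 <;> dsimp only <;> omega
    | e + 2 =>
      have h : stereoMonomial a b c (e + 2) = stereoMonomial a b c (e + 1) -
          (stereoMonomial (a + 2) b c e + stereoMonomial a (b + 2) c e +
            stereoMonomial a b (c + 2) e) := by
        funext x
        simp only [stereoMonomial, Pi.sub_apply, Pi.add_apply]
        linear_combination ((x 0 * conf x) ^ a * (x 1 * conf x) ^ b * (x 2 * conf x) ^ c *
          conf x ^ e) * conf_sq x
      rw [h]
      exact Submodule.sub_mem _ (ih _ (by omega) _ _ _ (by omega))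
        (Submodule.add_mem _ (Submodule.add_mem _ (ih _ (by omega) _ _ _ (by omega))
          (ih _ (by omega) _ _ _ (by omega))) (ih _ (by omega) _ _ _ (by omega)))

theorem HNspace_le_span (N : ℕ) :
    HNspace N ≤ Submodule.span ℝ
      (Set.range fun α : {α // α ∈ LamStar N} => mulWeight (reducedMonomial α.1)) := by
  refine (HNspace_le_map_mulWeight N).trans
    ((Submodule.map_mono (stereoFiltration_le_span_reducedMonomial N)).trans ?_)
  rw [Submodule.map_span, Set.image_image, Set.image_eq_range]
  rfl

/-- For `N ≥ 1`, the family `(𝒲_α)_{α∈Λ*_N}` is a basis of `H_N`: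
each `𝒲_α` belongs to `H_N`, the family is linearly independent, and it spans `H_N`. -/
theorem AB_basis_of_HN (N : ℕ) (hN : 1 ≤ N) :
    (∀ α ∈ LamStar N, Wfun α ∈ HNspace N) ∧
    LinearIndependent ℝ (fun α : {α // α ∈ LamStar N} => Wfun α.1) ∧
    Submodule.span ℝ (Wfun '' (LamStar N : Set (ℕ × ℕ × ℤ))) = HNspace N := by
  have hmem : ∀ α ∈ LamStar N, Wfun α ∈ HNspace N := by
    rintro ⟨k, l, m⟩ hα
    rw [mem_LamStar] at hα
    exact map_mulWeight_le_HNspace N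
      (Submodule.map_mono (stereoFiltration_mono hα.1) (Wfun_mem_map_mulWeight hα.2.1 hα.2.2))
  have hli := linearIndependent_Wfun N
  refine ⟨hmem, hli, ?_⟩
  have hspan_le : Submodule.span ℝ (Wfun '' (LamStar N : Set (ℕ × ℕ × ℤ))) ≤ HNspace N := by
    rw [Submodule.span_le]
    rintro _ ⟨α, hα, rfl⟩
    exact hmem α hα
  have := FiniteDimensional.span_of_finite ℝ
    (Set.finite_range fun α : {α // α ∈ LamStar N} => mulWeight (reducedMonomial α.1))
  have : FiniteDimensional ℝ (HNspace N) :=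
    Submodule.finiteDimensional_of_le (HNspace_le_span N)
  refine Submodule.eq_of_le_of_finrank_le hspan_le ?_
  calc Module.finrank ℝ (HNspace N)
      ≤ Module.finrank ℝ (Submodule.span ℝ (Set.range
          fun α : {α // α ∈ LamStar N} => mulWeight (reducedMonomial α.1))) :=
        Submodule.finrank_mono (HNspace_le_span N)
    _ ≤ Fintype.card {α // α ∈ LamStar N} := finrank_range_le_card _
    _ = Module.finrank ℝ (Submodule.span ℝ (Wfun '' (LamStar N : Set (ℕ × ℕ × ℤ)))) := by
      have h := finrank_span_eq_card hli
      rw [← h, Set.image_eq_range]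
      rfl

end
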